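/- Let X be a set, F : X → X a map, ψ : X → ℂ^q a vector of observables, and x_1, …, x_m ∈ X data points. Let Y ∈ ℂ^{q×m} be the matrix whose k-th column is ψ(x_k) and Y# ∈ ℂ^{q×m} the matrix whose k-th column is ψ(F(x_k)). Suppose A ∈ ℂ^{q×q} satisfies A·Y = Y#, and suppose the columns of Y span ℂ^q. If w ∈ ℂ^q and μ ∈ ℂ are such that the function φ(x) = w*ψ(x) (the conjugate-transpose of w times ψ(x)) satisfies φ(F(x_k)) = μ·φ(x_k) for every k = 1, …, m, then w is a left eigenvector of A with eigenvalue μ, i.e., w*A = μ·w*. -/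

import Mathlib

open Matrix

/-- If `A·Y = Y#`, the columns of `Y` span `ℂ^q`, and the function
`φ(x) = w*ψ(x)` satisfies the Koopman eigenfunction equation `φ(F(x_k)) = μ·φ(x_k)`
on all data points, then `w` is a left eigenvector of `A` with eigenvalue `μ`. -/
theorem dmd_left_eigenvector_of_koopman_eigenfunction
    {X : Type*} {q m : ℕ} (F : X → X) (ψ : X → Fin q → ℂ) (x : Fin m → X)
    (A : Matrix (Fin q) (Fin q) ℂ)
    (Y Ysharp : Matrix (Fin q) (Fin m) ℂ)
    (hY : ∀ i k, Y i k = ψ (x k) i)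
    (hYsharp : ∀ i k, Ysharp i k = ψ (F (x k)) i)
    (hA : A * Y = Ysharp)
    (hspan : Submodule.span ℂ (Set.range fun k : Fin m => ψ (x k)) = ⊤)
    (w : Fin q → ℂ) (μ : ℂ)
    (hφ : ∀ k : Fin m, star w ⬝ᵥ ψ (F (x k)) = μ * (star w ⬝ᵥ ψ (x k))) :
    Matrix.vecMul (star w) A = μ • star w := by
  refine (dotProductEquiv ℂ (Fin q)).injective (LinearMap.ext_on_range hspan fun k => ?_)
  have hcol : A *ᵥ ψ (x k) = ψ (F (x k)) := by
    ext i
    rw [← hYsharp, ← hA, Matrix.mul_apply]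
    simp only [hY, mulVec, dotProduct]
  change star w ᵥ* A ⬝ᵥ ψ (x k) = (μ • star w) ⬝ᵥ ψ (x k)
  rw [← dotProduct_mulVec, hcol, hφ, smul_dotProduct, smul_eq_mul]
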